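/- With P = k[x,y,z,w], Φ a degree-3 Macaulay inverse system, ann Φ containing no nonzero linear form, p bijective, and SM = diag(α,0,0) with α ≠ 0, the following three identities hold in k: (1) c_w(ℓ_{yw})·c_w(ℓ_{yw}) − c_y(ℓ_{y²})·c_w(ℓ_{yw}) − c_x(ℓ_{y²}) = 0; (2) c_y(ℓ_{yz})·c_w(ℓ_{yw}) + c_x(ℓ_{yz}) = 0; and (3) c_w(ℓ_{yw})·c_y(ℓ_{yw}) + c_x(ℓ_{yw}) = 0. -/

import Mathlib

open MvPolynomial

noncomputable section

variable (k : Type*) [Field k]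

/-- The annihilator ideal `ann Φ = {f : Φ(f·g) = 0 for all g}` of the
linear functional `Φ`. -/
def annIdeal (Φ : MvPolynomial (Fin 4) k →ₗ[k] k) : Ideal (MvPolynomial (Fin 4) k) where
  carrier := {f | ∀ g, Φ (f * g) = 0}
  add_mem' := by
    intro a b ha hb g
    rw [add_mul, map_add, ha g, hb g, add_zero]
  zero_mem' := by intro g; simp
  smul_mem' := by
    intro c a ha g
    have h : c • a * g = a * (c * g) := by rw [smul_eq_mul]; ring
    rw [h]; exact ha (c * g)

/-- The Macaulay map `p : P₁ → Hom(P₁, k)`, `p(u)(v) = Φ(x·u·v)`. -/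
def pMap (Φ : MvPolynomial (Fin 4) k →ₗ[k] k) :
    homogeneousSubmodule (Fin 4) k 1 →ₗ[k]
      (homogeneousSubmodule (Fin 4) k 1 →ₗ[k] k) where
  toFun u :=
    { toFun := fun v => Φ (X 0 * u.1 * v.1)
      map_add' := fun v w => by simp [mul_add]
      map_smul' := fun c v => by simp [mul_smul_comm] }
  map_add' u u' := by
    ext v
    simp [add_mul, mul_add]
  map_smul' c u := by
    ext v
    simp [mul_smul_comm, smul_mul_assoc]

/-- The symmetric `3 × 3` matrix `SM` of (6.3), built from the Macaulay inverse
system `Φ` and the linear forms `ℓ_q` (`p⁻¹(q·Φ)` for the quadrics `q`);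
here `⟨q,q'⟩ = Φ(q·ℓ_{q'})`. -/
def smMatrix (Φ : MvPolynomial (Fin 4) k →ₗ[k] k)
    (ly2 lyz lyw lz2 lzw lw2 : MvPolynomial (Fin 4) k) : Matrix (Fin 3) (Fin 3) k :=
  !![Φ (X 2 ^ 2 * lw2) - Φ (X 2 * X 3 * lzw),
      Φ (X 2 * X 3 * lyw) - Φ (X 2 * X 1 * lw2),
      Φ (X 1 * X 2 * lzw) - Φ (X 2 ^ 2 * lyw);
    Φ (X 1 * X 3 * lzw) - Φ (X 1 * X 2 * lw2),
      Φ (X 1 ^ 2 * lw2) - Φ (X 1 * X 3 * lyw),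
      Φ (X 1 * X 2 * lyw) - Φ (X 1 ^ 2 * lzw);
    Φ (X 1 * X 2 * lzw) - Φ (X 1 * X 3 * lz2),
      Φ (X 1 * X 3 * lyz) - Φ (X 1 ^ 2 * lzw),
      Φ (X 1 ^ 2 * lz2) - Φ (X 1 * X 2 * lyz)]

/-- The coefficient of the variable `Xᵢ` in a polynomial. -/
def varCoeff (i : Fin 4) (u : MvPolynomial (Fin 4) k) : k :=
  MvPolynomial.coeff (Finsupp.single i 1) u

theorem abstract_ids {k A : Type*} [Field k] [AddCommGroup A] [Module k A]
    (mul : A →ₗ[k] A →ₗ[k] A) (B : A →ₗ[k] A →ₗ[k] k)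
    (hc : ∀ u v, mul u v = mul v u) (hB : ∀ u v, B u v = B v u)
    (ha : ∀ u v t, B (mul u v) t = B u (mul v t))
    (hn : ∀ u, (∀ v, B u v = 0) → u = 0)
    (x y z w : A) (cx cy cz cw : A →ₗ[k] k)
    (hdec : ∀ u, u = cx u • x + cy u • y + cz u • z + cw u • w)
    (hxx : cx x = 1) (hxy : cx y = 0) (hxz : cx z = 0) (hxw : cx w = 0)
    (hyx : cy x = 0) (hyy : cy y = 1) (hyz : cy z = 0) (hyw : cy w = 0)
    (hzx : cz x = 0) (hzy : cz y = 0) (hzz : cz z = 1) (hzw : cz w = 0)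
    (hwx : cw x = 0) (hwy : cw y = 0) (hwz : cw z = 0) (hww : cw w = 1)
    (h1 : ∀ u, mul x u = u) (α : k) (hα : α ≠ 0)
    (s11 : B (mul z z) (mul w w) - B (mul z w) (mul z w) = α)
    (s21 : B (mul y w) (mul z w) - B (mul y z) (mul w w) = 0)
    (s31 : B (mul y z) (mul z w) - B (mul y w) (mul z z) = 0)
    (s22 : B (mul y y) (mul w w) - B (mul y w) (mul y w) = 0)
    (s32 : B (mul y w) (mul y z) - B (mul y y) (mul z w) = 0)
    (s33 : B (mul y y) (mul z z) - B (mul y z) (mul y z) = 0) :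
    cw (mul y w) * cw (mul y w) - cy (mul y y) * cw (mul y w) - cx (mul y y) = 0 ∧
    cy (mul y z) * cw (mul y w) + cx (mul y z) = 0 ∧
    cw (mul y w) * cy (mul y w) + cx (mul y w) = 0 := by
  have ext1 : ∀ f g : A →ₗ[k] k, f x = g x → f y = g y → f z = g z → f w = g w →
      ∀ u, f u = g u := by
    intro f g a b c d u
    rw [hdec u]
    simp only [map_add, map_smul, a, b, c, d]
  have hn' : ∀ u u', (∀ v, B u v = B u' v) → u = u' := by
    intro u u' h
    rw [← sub_eq_zero]
    apply hn
    intro v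
    rw [map_sub, LinearMap.sub_apply, h v, sub_self]
  have hx1 : ∀ u, mul u x = u := fun u => by rw [hc, h1]
  -- transfer: B (a (b u)) v = B (b u) (a v)
  have tr : ∀ a b v, B (mul a b) v = B b (mul a v) := fun a b v => by rw [hc a b, ha]
  have ext2 : ∀ u u', B u x = B u' x → B u y = B u' y → B u z = B u' z → B u w = B u' w →
      u = u' := fun u u' a b c d => hn' u u' (ext1 (B u) (B u') a b c d)
  have czy := hc z y
  have cwy := hc w y
  have cwz := hc w z
  have comm : ∀ a b : A, B (mul b y) (mul a z) = B (mul a y) (mul b z) →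
      B (mul b y) (mul a w) = B (mul a y) (mul b w) →
      B (mul b z) (mul a w) = B (mul a z) (mul b w) →
      ∀ u, mul a (mul b u) = mul b (mul a u) := by
    intro a b h1 h2 h3 u
    have fx : ∀ v, B (mul b x) (mul a v) = B (mul a x) (mul b v) := by
      intro v
      rw [hx1, hx1, ← ha, ← ha, hc]
    have fs : ∀ u v, B (mul b u) (mul a v) = B (mul a u) (mul b v) →
        B (mul b v) (mul a u) = B (mul a v) (mul b u) := by
      intro u v h
      rw [hB, ← h, hB]
    have hb : ∀ v, (B (mul b x) (mul a v) = B (mul a x) (mul b v)) →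
        (B (mul b y) (mul a v) = B (mul a y) (mul b v)) →
        (B (mul b z) (mul a v) = B (mul a z) (mul b v)) →
        (B (mul b w) (mul a v) = B (mul a w) (mul b v)) →
        B (mul b u) (mul a v) = B (mul a u) (mul b v) := by
      intro v p q r s
      rw [hdec u]
      simp only [map_add, map_smul, LinearMap.add_apply, LinearMap.smul_apply, p, q, r, s]
    apply ext2 <;> rw [tr a (mul b u), tr b (mul a u)] <;> apply hb
    · exact fx _
    · exact fs _ _ (fx _)
    · exact fs _ _ (fx _)
    · exact fs _ _ (fx _)
    · exact fx _
    · exact hB _ _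
    · exact fs _ _ h1
    · exact fs _ _ h2
    · exact fx _
    · exact h1
    · exact hB _ _
    · exact fs _ _ h3
    · exact fx _
    · exact h2
    · exact h3
    · exact hB _ _
  have kz : ∀ u, mul y (mul z u) = mul z (mul y u) := by
    apply comm
    · rw [czy]; linear_combination -s33
    · rw [czy, hB]; linear_combination s32
    · rw [hB]; linear_combination -s31
  have kw : ∀ u, mul y (mul w u) = mul w (mul y u) := by
    apply comm
    · rw [cwy, cwz]; linear_combination s32
    · rw [cwy]; linear_combination -s22
    · rw [cwz, hB]; linear_combination s21
  -- the alternating form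
  let om : A → A → k := fun u v => B (mul w u) (mul z v) - B (mul z u) (mul w v)
  have omd : ∀ u v, om u v = B (mul w u) (mul z v) - B (mul z u) (mul w v) := fun _ _ => rfl
  have omx : ∀ v, om x v = 0 := by
    intro v
    rw [omd, hx1, hx1, ← ha, ← ha, hc w z, sub_self]
  have oml : ∀ u v, om u v = cx u * om x v + cy u * om y v + cz u * om z v + cw u * om w v := by
    intro u v
    conv_lhs => rw [hdec u]
    simp only [omd, map_add, map_smul, LinearMap.add_apply, LinearMap.smul_apply, smul_eq_mul]
    ring
  have oalt : ∀ u v, om u v = - om v u := by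
    intro u v
    rw [omd, omd, hB (mul w u), hB (mul z u)]; ring
  have ozz : om z z = 0 := by rw [omd, hB, sub_self]
  have oww : om w w = 0 := by rw [omd, hB, sub_self]
  have owz : om w z = α := by rw [omd, hB, cwz]; exact s11
  have ozw : om z w = -α := by rw [oalt, owz]
  have oyz : om y z = 0 := by rw [omd]; rw [cwy, czy, cwz]; linear_combination -s31
  have oyw : om y w = 0 := by rw [omd, cwy, czy]; exact s21
  have oyy : om y y = 0 := by rw [omd, hB, sub_self]
  have oy : ∀ v, om y v = 0 := by
    intro v
    rw [oalt, oml v y, omx, oyy, oalt z y, oyz, oalt w y, oyw]; ring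
  have osa : ∀ u v, om (mul y u) v = om u (mul y v) := by
    intro u v
    rw [omd, omd, ← kw u, ← kz u, tr y, tr y, kz v, kw v]
  have osz : om (mul y z) z = 0 := by
    rw [omd, ← kw z, tr y, kz z, hB, sub_self]
  have osw : om (mul y w) w = 0 := by
    rw [omd, ← kz w, tr y, kw w, hB, sub_self]
  have e1 := oml (mul y y) z
  have e2 := oml (mul y y) w
  have e3 := oml (mul y z) z
  have e4 := oml (mul y z) w
  have e5 := oml (mul y w) w
  have e6 := oml (mul y w) z
  have e7 := osa z w
  rw [oalt z (mul y w), e4, e6] at e7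
  rw [osa, oy, omx, ozz, owz, oy] at e1
  rw [osa, oy, omx, oww, ozw, oy] at e2
  rw [osz, omx, ozz, owz, oy] at e3
  rw [osw, omx, oww, ozw, oy] at e5
  rw [omx, omx, oy, oy, ozw, oww, ozz, owz] at e7
  have f1 : cw (mul y y) = 0 := by grind
  have f2 : cz (mul y y) = 0 := by grind
  have f3 : cw (mul y z) = 0 := by grind
  have f5 : cz (mul y w) = 0 := by grind
  have f7 : cz (mul y z) = cw (mul y w) := by grind
  have dyy := hdec (mul y y)
  have dyz := hdec (mul y z)
  have dyw := hdec (mul y w)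
  rw [f1, f2, zero_smul, zero_smul, add_zero, add_zero] at dyy
  rw [f3, f7, zero_smul, add_zero] at dyz
  rw [f5, zero_smul, add_zero] at dyw
  have gz := kz y
  have gw := kw y
  rw [czy, hc z] at gz
  rw [cwy, hc w] at gw
  generalize cx (mul y y) = a at *
  generalize cy (mul y y) = b at *
  generalize cx (mul y z) = e at *
  generalize cy (mul y z) = f at *
  generalize cx (mul y w) = e' at *
  generalize cy (mul y w) = f' at *
  generalize cw (mul y w) = l at *
  rw [dyz, dyy] at gz
  rw [dyw, dyy] at gw
  simp only [map_add, map_smul, LinearMap.add_apply, LinearMap.smul_apply, hx1, h1] at gz gw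
  rw [dyz, dyy] at gz
  rw [dyw, dyy] at gw
  have gzz := congrArg cz gz
  have gzy := congrArg cy gz
  have gwy := congrArg cy gw
  simp only [map_add, map_smul, smul_eq_mul, hxx, hxy, hxz, hxw, hyx, hyy, hyz, hyw, hzx, hzy,
    hzz, hzw, hwx, hwy, hwz, hww] at gzz gzy gwy
  refine ⟨?_, ?_, ?_⟩
  · linear_combination gzz
  · linear_combination gzy
  · linear_combination gwy

theorem lin_decomp {k : Type*} [Field k] (u : MvPolynomial (Fin 4) k)
    (hu : u ∈ homogeneousSubmodule (Fin 4) k 1) :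
    u = varCoeff k 0 u • X 0 + varCoeff k 1 u • X 1 + varCoeff k 2 u • X 2 +
      varCoeff k 3 u • X 3 := by
  rw [mem_homogeneousSubmodule] at hu
  have h : u = ∑ i : Fin 4, varCoeff k i u • (X i : MvPolynomial (Fin 4) k) := by
    ext m
    simp only [coeff_sum, coeff_smul, coeff_X', smul_eq_mul, varCoeff]
    by_cases hm : m.degree = 1
    · have hm' : m.sum (fun _ n => n) = 1 := hm
      obtain ⟨i, rfl⟩ := (Finsupp.sum_eq_one_iff m).1 hm'
      simp [Finsupp.single_left_inj]
    · rw [hu.coeff_eq_zero hm]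
      symm
      apply Finset.sum_eq_zero
      intro i _
      rw [if_neg, mul_zero]
      rintro rfl
      exact hm (by simp)
  conv_lhs => rw [h]
  rw [Fin.sum_univ_four]

/-- coefficient functional on linear forms -/
def coefL (k : Type*) [Field k] (i : Fin 4) : homogeneousSubmodule (Fin 4) k 1 →ₗ[k] k where
  toFun u := varCoeff k i u.1
  map_add' u v := by simp [varCoeff]
  map_smul' c u := by simp [varCoeff]

/-- the trilinear form -/
def triL (k : Type*) [Field k] (Φ : MvPolynomial (Fin 4) k →ₗ[k] k) :
    homogeneousSubmodule (Fin 4) k 1 →ₗ[k] homogeneousSubmodule (Fin 4) k 1 →ₗ[k]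
      (homogeneousSubmodule (Fin 4) k 1 →ₗ[k] k) :=
  LinearMap.mk₂ k
    (fun u v =>
      { toFun := fun t => Φ (u.1 * v.1 * t.1)
        map_add' := fun v w => by simp [mul_add]
        map_smul' := fun c v => by simp [mul_smul_comm] })
    (fun a b c => by ext t; simp [add_mul])
    (fun a b c => by ext t; simp [smul_mul_assoc])
    (fun a b c => by ext t; simp [add_mul, mul_add])
    (fun a b c => by ext t; simp [smul_mul_assoc, mul_smul_comm])

theorem triL_apply (k : Type*) [Field k] (Φ : MvPolynomial (Fin 4) k →ₗ[k] k)
    (u v t : homogeneousSubmodule (Fin 4) k 1) : triL k Φ u v t = Φ (u.1 * v.1 * t.1) := rfl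

/-- the degree one piece variables -/
def varL (k : Type*) [Field k] (i : Fin 4) : homogeneousSubmodule (Fin 4) k 1 :=
  ⟨X i, (mem_homogeneousSubmodule _ _).2 (isHomogeneous_X _ _)⟩

theorem coefL_var (k : Type*) [Field k] (i j : Fin 4) :
    coefL k i (varL k j) = if j = i then 1 else 0 := by
  simp [coefL, varL, varCoeff, coeff_X', Finsupp.single_left_inj]

/-- **Lemma 13.5** (vanishing of the constants `q₃`, `q₄`, `q₅`, via
Lemma 12.3 (g), (h), (i)).  Assume `Φ` is a degree-3 Macaulay inverse system on
`P = k[x,y,z,w]` whose annihilator contains no nonzero linear form, `p` is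
bijective, and `SM = diag(α,0,0)` with `α ≠ 0`.  Then
`c_w(ℓ_{yw})² − c_y(ℓ_{y²})·c_w(ℓ_{yw}) − c_x(ℓ_{y²}) = 0`,
`c_y(ℓ_{yz})·c_w(ℓ_{yw}) + c_x(ℓ_{yz}) = 0`, and
`c_w(ℓ_{yw})·c_y(ℓ_{yw}) + c_x(ℓ_{yw}) = 0`. -/
theorem scalar_identities_of_smMatrix_rank_one
    (Φ : MvPolynomial (Fin 4) k →ₗ[k] k)
    (hΦ : ∀ m : Fin 4 →₀ ℕ, (m.sum fun _ e => e) ≠ 3 → Φ (monomial m 1) = 0)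
    (hlin : ∀ u ∈ homogeneousSubmodule (Fin 4) k 1, u ∈ annIdeal k Φ → u = 0)
    (hp : Function.Bijective (pMap k Φ))
    (ly2 lyz lyw lz2 lzw lw2 : MvPolynomial (Fin 4) k)
    (hly2m : ly2 ∈ homogeneousSubmodule (Fin 4) k 1)
    (hlyzm : lyz ∈ homogeneousSubmodule (Fin 4) k 1)
    (hlywm : lyw ∈ homogeneousSubmodule (Fin 4) k 1)
    (hlz2m : lz2 ∈ homogeneousSubmodule (Fin 4) k 1)
    (hlzwm : lzw ∈ homogeneousSubmodule (Fin 4) k 1)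
    (hlw2m : lw2 ∈ homogeneousSubmodule (Fin 4) k 1)
    (hly2 : ∀ v ∈ homogeneousSubmodule (Fin 4) k 1,
      Φ (X 0 * ly2 * v) = Φ (X 1 ^ 2 * v))
    (hlyz : ∀ v ∈ homogeneousSubmodule (Fin 4) k 1,
      Φ (X 0 * lyz * v) = Φ (X 1 * X 2 * v))
    (hlyw : ∀ v ∈ homogeneousSubmodule (Fin 4) k 1,
      Φ (X 0 * lyw * v) = Φ (X 1 * X 3 * v))
    (hlz2 : ∀ v ∈ homogeneousSubmodule (Fin 4) k 1,
      Φ (X 0 * lz2 * v) = Φ (X 2 ^ 2 * v))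
    (hlzw : ∀ v ∈ homogeneousSubmodule (Fin 4) k 1,
      Φ (X 0 * lzw * v) = Φ (X 2 * X 3 * v))
    (hlw2 : ∀ v ∈ homogeneousSubmodule (Fin 4) k 1,
      Φ (X 0 * lw2 * v) = Φ (X 3 ^ 2 * v))
    (α : k) (hα : α ≠ 0)
    (hSM : smMatrix k Φ ly2 lyz lyw lz2 lzw lw2 = !![α, 0, 0; 0, 0, 0; 0, 0, 0]) :
    varCoeff k 3 lyw * varCoeff k 3 lyw -
        varCoeff k 1 ly2 * varCoeff k 3 lyw - varCoeff k 0 ly2 = 0 ∧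
      varCoeff k 1 lyz * varCoeff k 3 lyw + varCoeff k 0 lyz = 0 ∧
      varCoeff k 3 lyw * varCoeff k 1 lyw + varCoeff k 0 lyw = 0 := by
  let e := LinearEquiv.ofBijective (pMap k Φ) hp
  let mul := (triL k Φ).compr₂ e.symm.toLinearMap
  have hBm : ∀ u v, pMap k Φ (mul u v) = triL k Φ u v := fun u v =>
    e.apply_symm_apply (triL k Φ u v)
  have hBa : ∀ u v : homogeneousSubmodule (Fin 4) k 1,
    pMap k Φ u v = Φ (X 0 * u.1 * v.1) := fun _ _ => rfl
  have hmul : ∀ u v q, pMap k Φ q = triL k Φ u v → mul u v = q := by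
    intro u v q h
    apply hp.1
    rw [hBm, h]
  have hBs : ∀ u v, pMap k Φ u v = pMap k Φ v u := by
    intro u v
    rw [hBa, hBa, mul_right_comm]
  have hBt : ∀ u v t : homogeneousSubmodule (Fin 4) k 1,
      pMap k Φ (mul u v) t = Φ (u.1 * v.1 * t.1) := by
    intro u v t
    rw [hBm, triL_apply]
  have q1 : mul (varL k 1) (varL k 1) = ⟨ly2, hly2m⟩ := by
    apply hmul; ext t
    rw [hBa, triL_apply]; simpa only [varL, pow_two] using hly2 t.1 t.2
  have q2 : mul (varL k 1) (varL k 2) = ⟨lyz, hlyzm⟩ := by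
    apply hmul; ext t
    rw [hBa, triL_apply]; simpa only [varL, pow_two] using hlyz t.1 t.2
  have q3 : mul (varL k 1) (varL k 3) = ⟨lyw, hlywm⟩ := by
    apply hmul; ext t
    rw [hBa, triL_apply]; simpa only [varL, pow_two] using hlyw t.1 t.2
  have q4 : mul (varL k 2) (varL k 2) = ⟨lz2, hlz2m⟩ := by
    apply hmul; ext t
    rw [hBa, triL_apply]; simpa only [varL, pow_two] using hlz2 t.1 t.2
  have q5 : mul (varL k 2) (varL k 3) = ⟨lzw, hlzwm⟩ := by
    apply hmul; ext t
    rw [hBa, triL_apply]; simpa only [varL, pow_two] using hlzw t.1 t.2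
  have q6 : mul (varL k 3) (varL k 3) = ⟨lw2, hlw2m⟩ := by
    apply hmul; ext t
    rw [hBa, triL_apply]; simpa only [varL, pow_two] using hlw2 t.1 t.2
  have m00 := congrFun (congrFun hSM 0) 0
  have m10 := congrFun (congrFun hSM 1) 0
  have m20 := congrFun (congrFun hSM 2) 0
  have m11 := congrFun (congrFun hSM 1) 1
  have m21 := congrFun (congrFun hSM 2) 1
  have m22 := congrFun (congrFun hSM 2) 2
  simp [smMatrix] at m00 m10 m20 m11 m21 m22
  have main := abstract_ids mul (pMap k Φ)
    (fun u v => hmul _ _ _ (by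
      ext t; rw [hBt, triL_apply, mul_comm v.1]))
    hBs
    (fun u v t => by
      rw [hBs u, hBt, hBt]; congr 1; ring)
    (fun u h => hp.1 (by ext v; rw [h v]; simp))
    (varL k 0) (varL k 1) (varL k 2) (varL k 3) (coefL k 0) (coefL k 1) (coefL k 2) (coefL k 3)
    (fun u => Subtype.ext (lin_decomp u.1 u.2))
    (by simp [coefL_var]) (by simp [coefL_var]) (by simp [coefL_var]) (by simp [coefL_var])
    (by simp [coefL_var]) (by simp [coefL_var]) (by simp [coefL_var]) (by simp [coefL_var])
    (by simp [coefL_var]) (by simp [coefL_var]) (by simp [coefL_var]) (by simp [coefL_var])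
    (by simp [coefL_var]) (by simp [coefL_var]) (by simp [coefL_var]) (by simp [coefL_var])
    (fun u => hmul _ _ _ rfl) α hα
    (by rw [hBt, hBt, q6, q5]; simp only [varL, ← pow_two]; exact m00)
    (by rw [hBt, hBt, q6, q5]; simp only [varL]; linear_combination m10)
    (by rw [hBt, hBt, q4, q5]; simp only [varL]; linear_combination m20)
    (by rw [hBt, hBt, q6, q3]; simp only [varL, ← pow_two]; linear_combination m11)
    (by rw [hBt, hBt, q2, q5]; simp only [varL, ← pow_two]; linear_combination m21)
    (by rw [hBt, hBt, q4, q2]; simp only [varL, ← pow_two]; linear_combination m22)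
  rw [q1, q2, q3] at main
  exact main

end
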